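/- Let α be a flow on a unital C*-algebra A with generator δ_α, and let u : [0,∞) → U(A) be a continuous path of unitaries such that max_{0≤t≤1} ‖α_t(u(s)) − u(s)‖ → 0 as s → ∞. Then there exists a continuous path v : [0,∞) → U(A) of unitaries such that v(s) ∈ D(δ_α) for all s, ‖δ_α(v(s))‖ → 0, and ‖u(s) − v(s)‖ → 0 as s → ∞. -/

import Mathlib

open Filter Topology

theorem norm_choose_neg_half_le_one (n : ℕ) : ‖Ring.choose (-1 / 2 : ℂ) n‖ ≤ 1 := by
  induction n with
  | zero => simp
  | succ n ih =>
    have h := Ring.choose_smul_choose (-1 / 2 : ℂ) (Nat.le_succ n)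
    simp only [Nat.succ_eq_add_one, Nat.choose_succ_self_right, Nat.add_sub_cancel_left,
      Ring.choose_one_right, nsmul_eq_mul] at h
    have h' := congrArg norm h
    rw [norm_mul, norm_mul, Complex.norm_natCast,
      show (-1 / 2 - n : ℂ) = ((-(1 / 2 + n) : ℝ) : ℂ) by push_cast; ring,
      Complex.norm_real, norm_neg, Real.norm_of_nonneg (by positivity)] at h'
    push_cast at h'
    have hn : (0 : ℝ) ≤ n := n.cast_nonneg
    nlinarith [norm_nonneg (Ring.choose (-1 / 2 : ℂ) n),
      norm_nonneg (Ring.choose (-1 / 2 : ℂ) (n + 1))]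

theorem choose_neg_one (n : ℕ) : Ring.choose (-1 : ℂ) n = (-1) ^ n := by
  rw [Ring.choose_neg', Ring.multichoose_one, Int.negOnePow_def]
  simp [Units.smul_def]

theorem star_choose_neg_half (n : ℕ) :
    star (Ring.choose (-1 / 2 : ℂ) n) = Ring.choose (-1 / 2 : ℂ) n := by
  have h := Ring.map_choose (starRingEnd ℂ) (-1 / 2 : ℂ) n
  rwa [map_div₀, map_neg, map_one, map_ofNat] at h

section InvSqrt

variable {A : Type*} [NormedRing A] [NormedAlgebra ℂ A]

/-- The binomial series `∑ (-1/2 choose n) kⁿ` for `(1 + k) ^ (-1/2)`. -/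
noncomputable def invSqrtOneAdd (k : A) : A := ∑' n : ℕ, Ring.choose (-1 / 2 : ℂ) n • k ^ n

variable [NormOneClass A]

theorem norm_choose_smul_pow_le (k : A) (n : ℕ) :
    ‖Ring.choose (-1 / 2 : ℂ) n • k ^ n‖ ≤ ‖k‖ ^ n := by
  rw [norm_smul]
  have := norm_choose_neg_half_le_one n
  calc _ ≤ 1 * ‖k‖ ^ n := by gcongr; exact norm_pow_le k n
    _ = _ := one_mul _

theorem summable_norm_invSqrtOneAdd {k : A} (hk : ‖k‖ < 1) :
    Summable fun n : ℕ => ‖Ring.choose (-1 / 2 : ℂ) n • k ^ n‖ :=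
  (summable_geometric_of_lt_one (norm_nonneg k) hk).of_nonneg_of_le (fun _ => norm_nonneg _)
    (norm_choose_smul_pow_le k)

variable [CompleteSpace A]

theorem hasSum_invSqrtOneAdd {k : A} (hk : ‖k‖ < 1) :
    HasSum (fun n : ℕ => Ring.choose (-1 / 2 : ℂ) n • k ^ n) (invSqrtOneAdd k) :=
  (summable_norm_invSqrtOneAdd hk).of_norm.hasSum

theorem commute_invSqrtOneAdd {k : A} (hk : ‖k‖ < 1) : Commute k (invSqrtOneAdd k) := by
  refine HasSum.unique ?_ ((hasSum_invSqrtOneAdd hk).mul_right k)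
  convert (hasSum_invSqrtOneAdd hk).mul_left k using 2 with n
  rw [mul_smul_comm, smul_mul_assoc, ← pow_succ, ← pow_succ']

theorem invSqrtOneAdd_mul_self {k : A} (hk : ‖k‖ < 1) :
    invSqrtOneAdd k * invSqrtOneAdd k * (1 + k) = 1 := by
  have h : invSqrtOneAdd k * invSqrtOneAdd k = ∑' n : ℕ, (-k) ^ n := by
    rw [invSqrtOneAdd, tsum_mul_tsum_eq_tsum_sum_antidiagonal_of_summable_norm
      (summable_norm_invSqrtOneAdd hk) (summable_norm_invSqrtOneAdd hk)]
    refine tsum_congr fun n => ?_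
    have hn : ∀ kl ∈ Finset.HasAntidiagonal.antidiagonal n,
        Ring.choose (-1 / 2 : ℂ) kl.1 • k ^ kl.1 * Ring.choose (-1 / 2 : ℂ) kl.2 • k ^ kl.2 =
          (Ring.choose (-1 / 2 : ℂ) kl.1 * Ring.choose (-1 / 2 : ℂ) kl.2) • k ^ n := by
      intro kl hkl
      rw [smul_mul_smul_comm, ← pow_add, Finset.HasAntidiagonal.mem_antidiagonal.mp hkl]
    rw [Finset.sum_congr rfl hn, ← Finset.sum_smul, ← Ring.add_choose_eq n (Commute.all _ _),
      show (-1 / 2 + -1 / 2 : ℂ) = -1 by norm_num, choose_neg_one, neg_pow k, Algebra.smul_def]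
    simp
  rw [h, show 1 + k = 1 - -k by abel]
  exact geom_series_mul_neg (-k) (by simpa using hk)

theorem norm_invSqrtOneAdd_sub_one_le {k : A} (hk : ‖k‖ ≤ 1 / 2) :
    ‖invSqrtOneAdd k - 1‖ ≤ 2 * ‖k‖ := by
  have hk1 : ‖k‖ < 1 := by linarith
  have h : invSqrtOneAdd k - 1 = ∑' n : ℕ, Ring.choose (-1 / 2 : ℂ) (n + 1) • k ^ (n + 1) := by
    rw [invSqrtOneAdd, (hasSum_invSqrtOneAdd hk1).summable.tsum_eq_zero_add, pow_zero,
      Ring.choose_zero_right, one_smul, add_sub_cancel_left]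
  have hg : HasSum (fun n : ℕ => ‖k‖ ^ (n + 1)) ((1 - ‖k‖)⁻¹ - 1) := by
    have := (hasSum_nat_add_iff' 1).mpr (hasSum_geometric_of_lt_one (norm_nonneg k) hk1)
    rwa [Finset.sum_range_one, pow_zero] at this
  rw [h]
  refine (tsum_of_norm_bounded hg fun n => norm_choose_smul_pow_le k (n + 1)).trans ?_
  rw [inv_eq_one_div, div_sub_one (by linarith), div_le_iff₀ (by linarith)]
  nlinarith [norm_nonneg k]

theorem continuousOn_invSqrtOneAdd :
    ContinuousOn (invSqrtOneAdd : A → A) (Metric.closedBall 0 (1 / 2)) := by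
  refine continuousOn_tsum (fun n => by fun_prop)
    (summable_geometric_of_lt_one (by norm_num : (0 : ℝ) ≤ 1 / 2) (by norm_num)) ?_
  intro n k hk
  refine (norm_choose_smul_pow_le k n).trans ?_
  gcongr
  simpa using hk

/-- Along a curve with uniformly bounded speed `C`, the series `invSqrtOneAdd` is differentiable
with speed at most `4 * C`. -/
theorem exists_hasDerivAt_invSqrtOneAdd {f f' : ℝ → A} {C : ℝ}
    (hf : ∀ t, HasDerivAt f (f' t) t) (hf_le : ∀ t, ‖f t‖ ≤ 1 / 2) (hf' : ∀ t, ‖f' t‖ ≤ C)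
    (t : ℝ) : ∃ y : A, HasDerivAt (fun t => invSqrtOneAdd (f t)) y t ∧ ‖y‖ ≤ 4 * C := by
  have hC : 0 ≤ C := (norm_nonneg _).trans (hf' t)
  have hsum : HasSum (fun n : ℕ => 2 * C * (n * (1 / 2 : ℝ) ^ n)) (4 * C) := by
    have h := (hasSum_coe_mul_geometric_of_norm_lt_one
      (show ‖(1 / 2 : ℝ)‖ < 1 by norm_num)).mul_left (2 * C)
    rwa [show 2 * C * (1 / 2 / (1 - 1 / 2) ^ 2) = 4 * C by ring] at h
  have hbound : ∀ (n : ℕ) (t : ℝ), ‖Ring.choose (-1 / 2 : ℂ) n •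
      ∑ i ∈ Finset.range n, f t ^ (n.pred - i) * f' t * f t ^ i‖ ≤
        2 * C * (n * (1 / 2 : ℝ) ^ n) := by
    intro n t
    rw [norm_smul]
    have hterm : ∀ i ∈ Finset.range n, ‖f t ^ (n.pred - i) * f' t * f t ^ i‖ ≤
        2 * C * (1 / 2) ^ n := by
      intro i hi
      have hin := Finset.mem_range.mp hi
      have hp : ∀ m : ℕ, ‖f t ^ m‖ ≤ (1 / 2) ^ m := fun m =>
        (norm_pow_le _ _).trans (by gcongr; exact hf_le t)
      calc _ ≤ ‖f t ^ (n.pred - i)‖ * ‖f' t‖ * ‖f t ^ i‖ := norm_mul₃_le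
        _ ≤ (1 / 2) ^ (n.pred - i) * C * (1 / 2) ^ i := by
          gcongr
          exacts [hp _, hf' t, hp _]
        _ = C * (1 / 2) ^ (n.pred - i + i) := by ring
        _ = 2 * C * (1 / 2) ^ (n.pred - i + i + 1) := by ring
        _ = _ := by congr 2; rw [Nat.pred_eq_sub_one]; omega
    have hs := (norm_sum_le _ _).trans (Finset.sum_le_card_nsmul _ _ _ hterm)
    rw [Finset.card_range, nsmul_eq_mul] at hs
    calc _ ≤ 1 * _ := mul_le_mul (norm_choose_neg_half_le_one n) hs (norm_nonneg _) zero_le_one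
      _ = _ := by ring
  refine ⟨_, hasDerivAt_tsum hsum.summable (fun n t => ((hf t).fun_pow' n).const_smul _) hbound
    (y₀ := t) ?_ t, tsum_of_norm_bounded hsum fun n => hbound n t⟩
  exact (hasSum_invSqrtOneAdd ((hf_le t).trans_lt (by norm_num))).summable

end InvSqrt

theorem star_invSqrtOneAdd {A : Type*} [CStarAlgebra A] {k : A} (hk : IsSelfAdjoint k) :
    star (invSqrtOneAdd k) = invSqrtOneAdd k := by
  rw [invSqrtOneAdd, tsum_star]
  refine tsum_congr fun n => ?_
  rw [star_smul, star_choose_neg_half, (hk.pow n).star_eq]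

theorem StarAlgEquiv.map_invSqrtOneAdd {A : Type*} [CStarAlgebra A] [Nontrivial A]
    (φ : A ≃⋆ₐ[ℂ] A) {k : A} (hk : ‖k‖ < 1) :
    φ (invSqrtOneAdd k) = invSqrtOneAdd (φ k) := by
  have h := (hasSum_invSqrtOneAdd hk).map φ (StarAlgEquiv.isometry φ).continuous
  rw [← h.tsum_eq]
  exact tsum_congr fun n => by simp

/-- The unitary part `z |z|⁻¹` of an element `z` close to a unitary. -/
noncomputable def unitaryPart {A : Type*} [CStarAlgebra A] (z : A) : A :=
  z * invSqrtOneAdd (star z * z - 1)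

section UnitaryPart

variable {A : Type*} [CStarAlgebra A] [Nontrivial A] {u z : A}

theorem norm_le_of_norm_sub_unitary_le (hu : u ∈ unitary A) (hz : ‖z - u‖ ≤ 1 / 8) :
    ‖z‖ ≤ 9 / 8 := by
  have hu1 : ‖u‖ ≤ 1 := CStarRing.norm_of_mem_unitary hu |>.le
  have := norm_add_le u (z - u)
  rw [add_sub_cancel] at this
  linarith

theorem norm_star_mul_self_sub_one_le (hu : u ∈ unitary A) (hz : ‖z - u‖ ≤ 1 / 8) :
    ‖star z * z - 1‖ ≤ 3 * ‖z - u‖ := by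
  have hu1 : ‖u‖ ≤ 1 := CStarRing.norm_of_mem_unitary hu |>.le
  have hz1 := norm_le_of_norm_sub_unitary_le hu hz
  have h : star z * z - 1 = star z * (z - u) + star (z - u) * u := by
    rw [← Unitary.star_mul_self_of_mem hu, star_sub]
    noncomm_ring
  rw [h]
  have h1 := norm_mul_le (star z) (z - u)
  have h2 := norm_mul_le (star (z - u)) u
  rw [norm_star] at h1 h2
  have := norm_add_le (star z * (z - u)) (star (z - u) * u)
  nlinarith [norm_nonneg (z - u)]

theorem norm_star_mul_self_sub_one_le_half (hu : u ∈ unitary A) (hz : ‖z - u‖ ≤ 1 / 8) :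
    ‖star z * z - 1‖ ≤ 1 / 2 := by
  linarith [norm_star_mul_self_sub_one_le hu hz]

theorem unitaryPart_mem_unitary (hu : u ∈ unitary A) (hz : ‖z - u‖ ≤ 1 / 8) :
    unitaryPart z ∈ unitary A := by
  have hk : ‖star z * z - 1‖ < 1 :=
    (norm_star_mul_self_sub_one_le_half hu hz).trans_lt (by norm_num)
  have hsa : IsSelfAdjoint (star z * z - 1) := (IsSelfAdjoint.star_mul_self z).sub (.one A)
  have hS := invSqrtOneAdd_mul_self hk
  have hstar := star_invSqrtOneAdd hsa
  have hcomm := commute_invSqrtOneAdd hk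
  set S := invSqrtOneAdd (star z * z - 1) with hSdef
  rw [add_sub_cancel] at hS
  have hcomm' : Commute (star z * z) S := by
    have := hcomm.add_left (Commute.one_left S)
    rwa [sub_add_cancel] at this
  have hleft : star (unitaryPart z) * unitaryPart z = 1 := by
    rw [unitaryPart, ← hSdef, star_mul, hstar]
    calc S * star z * (z * S) = S * ((star z * z) * S) := by noncomm_ring
      _ = S * S * (star z * z) := by rw [hcomm'.eq, mul_assoc]
      _ = 1 := hS
  have hz_unit : IsUnit z := by
    have h : ‖1 - star u * z‖ < 1 := by
      rw [← Unitary.star_mul_self_of_mem hu, ← mul_sub]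
      refine (norm_mul_le _ _).trans_lt ?_
      rw [norm_star, CStarRing.norm_of_mem_unitary hu, norm_sub_rev]
      linarith
    have h' := (Unitary.toUnits ⟨u, hu⟩).isUnit.mul (isUnit_one_sub_of_norm_lt_one h)
    simpa [← mul_assoc, Unitary.mul_star_self_of_mem hu] using h'
  have hS_unit : IsUnit S := by
    refine isUnit_iff_exists.mpr ⟨S * (star z * z), by rw [← mul_assoc, hS], ?_⟩
    rw [mul_assoc, hcomm'.eq, ← mul_assoc, hS]
  obtain ⟨w, hw⟩ := hz_unit.mul hS_unit
  refine Unitary.mem_iff.mpr ⟨hleft, ?_⟩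
  rw [unitaryPart, ← hSdef, ← hw] at hleft ⊢
  rw [left_inv_eq_right_inv hleft w.mul_inv, Units.mul_inv]

theorem norm_unitaryPart_sub_le (hu : u ∈ unitary A) (hz : ‖z - u‖ ≤ 1 / 8) :
    ‖unitaryPart z - u‖ ≤ 8 * ‖z - u‖ := by
  have hS := norm_invSqrtOneAdd_sub_one_le (norm_star_mul_self_sub_one_le_half hu hz)
  have hk := norm_star_mul_self_sub_one_le hu hz
  have hz1 := norm_le_of_norm_sub_unitary_le hu hz
  have h : unitaryPart z - u = z * (invSqrtOneAdd (star z * z - 1) - 1) + (z - u) := by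
    rw [unitaryPart]
    noncomm_ring
  have hmul := norm_mul_le z (invSqrtOneAdd (star z * z - 1) - 1)
  have := norm_add_le (z * (invSqrtOneAdd (star z * z - 1) - 1)) (z - u)
  rw [h]
  nlinarith [norm_nonneg (z - u), norm_nonneg (invSqrtOneAdd (star z * z - 1) - 1)]

theorem continuousOn_unitaryPart {X : Type*} [TopologicalSpace X] {z : X → A} {s : Set X}
    (hz : ContinuousOn z s) (hz_le : ∀ x ∈ s, ‖star (z x) * z x - 1‖ ≤ 1 / 2) :
    ContinuousOn (fun x => unitaryPart (z x)) s := by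
  refine hz.mul (continuousOn_invSqrtOneAdd.comp (by fun_prop) fun x hx => ?_)
  simpa using hz_le x hx

end UnitaryPart

section Flow

variable {A : Type*} [CStarAlgebra A] {α : ℝ → A ≃⋆ₐ[ℂ] A}

theorem flow_zero (hgroup : ∀ s t : ℝ, ∀ x : A, α (s + t) x = α s (α t x)) (x : A) :
    α 0 x = x :=
  EquivLike.injective (α 0) (by rw [← hgroup, add_zero])

theorem flow_hasDerivAt (hgroup : ∀ s t : ℝ, ∀ x : A, α (s + t) x = α s (α t x)) {x y : A}
    (h : HasDerivAt (fun t : ℝ => α t x) y 0) (t : ℝ) :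
    HasDerivAt (fun t : ℝ => α t x) (α t y) t := by
  let L : A →L[ℂ] A :=
    ⟨(α t : A ≃⋆ₐ[ℂ] A).toAlgEquiv.toLinearMap, (StarAlgEquiv.isometry (α t)).continuous⟩
  have h1 : HasDerivAt (fun r : ℝ => α (r - t) x) y t :=
    HasDerivAt.comp_sub_const t t (by simpa using h)
  have h2 := (L.restrictScalars ℝ).hasFDerivAt.comp_hasDerivAt t h1
  refine h2.congr_of_eventuallyEq (.of_forall fun r => ?_)
  change α r x = α t (α (r - t) x)
  rw [← hgroup, add_sub_cancel]

/-- Averaging `x` along the flow over a window `[0, w]` gives an element of the domain of the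
generator. -/
theorem exists_hasDerivAt_flow_near (hgroup : ∀ s t : ℝ, ∀ x : A, α (s + t) x = α s (α t x))
    (hcont : ∀ x : A, Continuous fun t : ℝ => α t x) (x : A) {w η : ℝ} (hw : 0 < w)
    (hη : ∀ t ∈ Set.Icc 0 w, ‖α t x - x‖ ≤ η) :
    ∃ z : A, HasDerivAt (fun t : ℝ => α t z) (w⁻¹ • (α w x - x)) 0 ∧ ‖z - x‖ ≤ η := by
  have hint : ∀ a b : ℝ, IntervalIntegrable (fun t => α t x) MeasureTheory.volume a b :=
    fun a b => (hcont x).intervalIntegrable a b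
  refine ⟨w⁻¹ • ∫ t in (0 : ℝ)..w, α t x, ?_, ?_⟩
  · have hshift : ∀ s : ℝ, α s (w⁻¹ • ∫ t in (0 : ℝ)..w, α t x) =
        w⁻¹ • ((∫ t in (0 : ℝ)..(s + w), α t x) - ∫ t in (0 : ℝ)..s, α t x) := by
      intro s
      let L : A →L[ℂ] A :=
        ⟨(α s : A ≃⋆ₐ[ℂ] A).toAlgEquiv.toLinearMap, (StarAlgEquiv.isometry (α s)).continuous⟩
      change (L.restrictScalars ℝ) _ = _
      rw [map_smul, ← ContinuousLinearMap.intervalIntegral_comp_comm _ (hint 0 w),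
        intervalIntegral.integral_interval_sub_left (hint _ _) (hint _ _)]
      have : ∀ t : ℝ, (L.restrictScalars ℝ) (α t x) = α (s + t) x := fun t => (hgroup s t x).symm
      simp_rw [this]
      rw [intervalIntegral.integral_comp_add_left (fun t => α t x), add_zero]
    simp_rw [hshift]
    have hd : ∀ b : ℝ, HasDerivAt (fun s => ∫ t in (0 : ℝ)..s, α t x) (α b x) b := fun b =>
      (hcont x).integral_hasStrictDerivAt 0 b |>.hasDerivAt
    have h1 : HasDerivAt (fun s => ∫ t in (0 : ℝ)..(s + w), α t x) (α w x) 0 :=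
      HasDerivAt.comp_add_const 0 w (by simpa using hd w)
    have h0 := hd 0
    rw [flow_zero hgroup] at h0
    exact (h1.sub h0).const_smul _
  · have h : (w⁻¹ • ∫ t in (0 : ℝ)..w, α t x) - x = w⁻¹ • ∫ t in (0 : ℝ)..w, (α t x - x) := by
      rw [intervalIntegral.integral_sub (hint _ _) (by simp), intervalIntegral.integral_const,
        sub_zero, smul_sub, inv_smul_smul₀ hw.ne']
    rw [h, norm_smul, norm_inv, Real.norm_of_nonneg hw.le, inv_mul_le_iff₀ hw, mul_comm]
    have := intervalIntegral.norm_integral_le_of_norm_le_const (a := 0) (b := w) (C := η)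
      (f := fun t => α t x - x) fun t ht => by
        rw [Set.uIoc_of_le hw.le] at ht
        exact hη t ⟨ht.1.le, ht.2⟩
    simpa [abs_of_pos hw] using this

theorem exists_hasDerivAt_flow_dist_lt
    (hgroup : ∀ s t : ℝ, ∀ x : A, α (s + t) x = α s (α t x))
    (hcont : ∀ x : A, Continuous fun t : ℝ => α t x) (x : A) {ε : ℝ} (hε : 0 < ε) :
    ∃ z y : A, HasDerivAt (fun t : ℝ => α t z) y 0 ∧ ‖z - x‖ < ε := by
  obtain ⟨r, hr, h⟩ := Metric.continuousAt_iff.mp (hcont x).continuousAt (ε / 2) (by positivity)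
  obtain ⟨z, hz, hzx⟩ := exists_hasDerivAt_flow_near hgroup hcont x (w := r / 2) (η := ε / 2)
    (by positivity) fun t ht => by
      have := h (x := t) (by rw [Real.dist_0_eq_abs, abs_of_nonneg ht.1]; linarith [ht.2])
      rw [flow_zero hgroup, dist_eq_norm] at this
      exact this.le
  exact ⟨z, _, hz, by linarith⟩

theorem exists_hasDerivAt_flow_unitaryPart [Nontrivial A]
    (hgroup : ∀ s t : ℝ, ∀ x : A, α (s + t) x = α s (α t x)) {u z y : A} (hu : u ∈ unitary A)
    (hzu : ‖z - u‖ ≤ 1 / 8) (hz : HasDerivAt (fun t : ℝ => α t z) y 0) :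
    ∃ y' : A, HasDerivAt (fun t : ℝ => α t (unitaryPart z)) y' 0 ∧ ‖y'‖ ≤ 14 * ‖y‖ := by
  have hz1 := norm_le_of_norm_sub_unitary_le hu hzu
  have hk := norm_star_mul_self_sub_one_le_half hu hzu
  have hk1 : ‖star z * z - 1‖ < 1 := hk.trans_lt (by norm_num)
  have hS := norm_invSqrtOneAdd_sub_one_le hk
  set k := star z * z - 1 with hkdef
  have hkd : HasDerivAt (fun t : ℝ => α t k) (star y * z + star z * y) 0 := by
    have h := (hz.star.mul hz).sub_const 1
    simp only [flow_zero hgroup] at h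
    refine h.congr_of_eventuallyEq (.of_forall fun t => ?_)
    simp [hkdef, map_star]
  have hkd_le : ‖star y * z + star z * y‖ ≤ 9 / 4 * ‖y‖ := by
    have h1 := norm_mul_le (star y) z
    have h2 := norm_mul_le (star z) y
    rw [norm_star] at h1 h2
    have := norm_add_le (star y * z) (star z * y)
    nlinarith [norm_nonneg y]
  obtain ⟨y₁, hy₁, hy₁_le⟩ := exists_hasDerivAt_invSqrtOneAdd
    (fun t => flow_hasDerivAt hgroup hkd t) (C := 9 / 4 * ‖y‖)
    (fun t => by rwa [StarAlgEquiv.norm_map]) (fun t => by rwa [StarAlgEquiv.norm_map]) 0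
  have h := hz.mul hy₁
  simp only [flow_zero hgroup] at h
  refine ⟨_, h.congr_of_eventuallyEq (.of_forall fun t => ?_), ?_⟩
  · simp [unitaryPart, ← hkdef, StarAlgEquiv.map_invSqrtOneAdd _ hk1]
  · have hS2 : ‖invSqrtOneAdd k‖ ≤ 2 := by
      have := norm_add_le (invSqrtOneAdd k - 1) 1
      rw [sub_add_cancel, norm_one] at this
      linarith
    have h1 := norm_mul_le y (invSqrtOneAdd k)
    have h2 := norm_mul_le z y₁
    have := norm_add_le (y * invSqrtOneAdd k) (z * y₁)
    nlinarith [norm_nonneg y, norm_nonneg y₁]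

/-- The graph of the generator of a flow is convex. -/
theorem convex_flow_generator_graph (α : ℝ → A ≃⋆ₐ[ℂ] A) :
    Convex ℝ {p : A × A | HasDerivAt (fun t : ℝ => α t p.1) p.2 0} := by
  intro p hp q hq a b _ _ _
  have h := (HasDerivAt.const_smul a hp).add (HasDerivAt.const_smul b hq)
  refine h.congr_of_eventuallyEq (.of_forall fun t => ?_)
  have hsmul : ∀ (c : ℝ) (x : A), α t (c • x) = c • α t x := fun c x => by
    rw [← Complex.coe_smul, map_smul, Complex.coe_smul]
  simp [hsmul]

/-- A continuous path which is asymptotically invariant under a flow can be approximated by a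
continuous path in the domain of the generator, along which the generator tends to zero. -/
theorem exists_continuous_flow_generator_approx
    (hgroup : ∀ s t : ℝ, ∀ x : A, α (s + t) x = α s (α t x))
    (hcont : ∀ x : A, Continuous fun t : ℝ => α t x) {u : ℝ → A} (hu : Continuous u)
    (hconv : ∀ ε > 0, ∃ S : ℝ, ∀ s ≥ S, ∀ t ∈ Set.Icc (0 : ℝ) 1, ‖α t (u s) - u s‖ ≤ ε)
    {r : ℝ} (hr : 0 < r) :
    ∃ p : C(ℝ, A × A),
      (∀ s, HasDerivAt (fun t : ℝ => α t (p s).1) (p s).2 0 ∧ ‖(p s).1 - u s‖ < r) ∧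
      ∀ ε > 0, ∃ S : ℝ, ∀ s ≥ S, ‖(p s).1 - u s‖ ≤ ε ∧ ‖(p s).2‖ ≤ ε := by
  set G : Set (A × A) := {p | HasDerivAt (fun t : ℝ => α t p.1) p.2 0} with hG
  have hGne : G.Nonempty := ⟨0, by simpa [hG] using hasDerivAt_const (0 : ℝ) (0 : A)⟩
  let g : ℝ → ℝ := fun s => Metric.infDist (u s, (0 : A)) G + 1 / (1 + |s|)
  have hpos : ∀ s : ℝ, 0 < 1 + |s| := fun s => by positivity
  have hg : Continuous g :=
    ((Metric.continuous_infDist_pt G).comp (hu.prodMk continuous_const)).add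
      (continuous_const.div (by fun_prop) fun s => (hpos s).ne')
  have hg_lim : ∀ ε > 0, ∃ S : ℝ, ∀ s ≥ S, g s < ε := by
    intro ε hε
    obtain ⟨S, hS⟩ := hconv (ε / 2) (by positivity)
    refine ⟨max S (2 / ε), fun s hs => ?_⟩
    obtain ⟨z, hz, hzu⟩ := exists_hasDerivAt_flow_near hgroup hcont (u s) one_pos
      (hS s (le_of_max_le_left hs))
    rw [inv_one, one_smul] at hz
    have h1 : Metric.infDist (u s, (0 : A)) G ≤ ε / 2 := by
      refine (Metric.infDist_le_dist_of_mem (y := (z, α 1 (u s) - u s)) hz).trans ?_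
      rw [Prod.dist_eq, dist_comm, dist_eq_norm, dist_zero_left]
      exact max_le hzu (hS s (le_of_max_le_left hs) 1 ⟨zero_le_one, le_rfl⟩)
    have h2 : 1 / (1 + |s|) < ε / 2 := by
      rw [div_lt_iff₀ (hpos s)]
      have h3 : 2 / ε ≤ |s| := (le_of_max_le_right hs).trans (le_abs_self s)
      rw [div_le_iff₀ hε] at h3
      linarith
    exact (add_lt_add_of_le_of_lt h1 h2).trans_eq (add_halves ε)
  obtain ⟨S₀, hS₀⟩ := hg_lim r hr
  let T : ℝ → Set (A × A) := fun s =>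
    {p | p ∈ G ∧ ‖p.1 - u s‖ < r ∧ (S₀ ≤ s → dist p (u s, 0) < g s)}
  have hT : ∀ s, Convex ℝ (T s) := by
    intro s p hp q hq a b ha hb hab
    refine ⟨convex_flow_generator_graph α hp.1 hq.1 ha hb hab, ?_, fun hs =>
      convex_ball (u s, (0 : A)) (g s) (hp.2.2 hs) (hq.2.2 hs) ha hb hab⟩
    have := convex_ball (u s) r (mem_ball_iff_norm.mpr hp.2.1) (mem_ball_iff_norm.mpr hq.2.1)
      ha hb hab
    exact mem_ball_iff_norm.mp this
  have hlocal : ∀ s, ∃ p : A × A, ∀ᶠ s' in 𝓝 s, p ∈ T s' := by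
    intro s
    have hr_near : ∀ p : A × A, ‖p.1 - u s‖ < r → ∀ᶠ s' in 𝓝 s, ‖p.1 - u s'‖ < r := fun p hp =>
      (continuous_const.sub hu).norm.continuousAt.eventually_lt continuousAt_const hp
    rcases lt_or_ge s S₀ with hs | hs
    · obtain ⟨z, y, hz, hzu⟩ := exists_hasDerivAt_flow_dist_lt hgroup hcont (u s) hr
      refine ⟨(z, y), ?_⟩
      filter_upwards [hr_near (z, y) hzu, eventually_lt_nhds hs] with s' h1 h2
      exact ⟨hz, h1, fun h => absurd h2 h.not_gt⟩
    · obtain ⟨p, hpG, hp⟩ := (Metric.infDist_lt_iff hGne).mp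
        (show Metric.infDist (u s, (0 : A)) G < g s from
          lt_add_of_pos_right _ (one_div_pos.mpr (hpos s)))
      rw [dist_comm] at hp
      have hp1 : ‖p.1 - u s‖ < r := by
        rw [← dist_eq_norm]
        exact ((le_max_left _ _).trans_lt hp).trans (hS₀ s hs)
      refine ⟨p, ?_⟩
      have hd : ∀ᶠ s' in 𝓝 s, dist p (u s', 0) < g s' :=
        (continuous_const.dist (hu.prodMk continuous_const)).continuousAt.eventually_lt
          hg.continuousAt hp
      filter_upwards [hr_near p hp1, hd] with s' h1 h2
      exact ⟨hpG, h1, fun _ => h2⟩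
  obtain ⟨p, hp⟩ := exists_continuous_forall_mem_convex_of_local_const hT hlocal
  refine ⟨p, fun s => ⟨(hp s).1, (hp s).2.1⟩, fun ε hε => ?_⟩
  obtain ⟨S, hS⟩ := hg_lim ε hε
  refine ⟨max S₀ S, fun s hs => ?_⟩
  have h := ((hp s).2.2 (le_of_max_le_left hs)).trans (hS s (le_of_max_le_right hs))
  rw [Prod.dist_eq, max_lt_iff, dist_eq_norm, dist_zero_right] at h
  exact ⟨h.1.le, h.2.le⟩

end Flow



/-- Let `α` be a flow on a unital C*-algebra with generator `δ_α`, and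
`u : [0,∞) → U(A)` a continuous path of unitaries with
`max_{0≤t≤1} ‖α_t(u(s)) − u(s)‖ → 0` as `s → ∞`. Then there is a continuous path
`v : [0,∞) → U(A)` with `v(s) ∈ D(δ_α)`, `‖δ_α(v(s))‖ → 0` and `‖u(s) − v(s)‖ → 0`. -/
theorem smoothing_almost_invariant_unitaries
    {A : Type*} [CStarAlgebra A]
    (α : ℝ → A ≃⋆ₐ[ℂ] A)
    (hgroup : ∀ s t : ℝ, ∀ x : A, α (s + t) x = α s (α t x))
    (hcont : ∀ x : A, Continuous fun t : ℝ => α t x)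
    (Dδ : Set A) (δ : A → A)
    (hgen : ∀ x : A, x ∈ Dδ ↔ ∃ y : A, HasDerivAt (fun t : ℝ => α t x) y 0)
    (hδ : ∀ x ∈ Dδ, HasDerivAt (fun t : ℝ => α t x) (δ x) 0)
    (u : ℝ → A)
    (hu : ∀ s : ℝ, 0 ≤ s → u s ∈ unitary A)
    (hucont : ContinuousOn u (Set.Ici (0:ℝ)))
    (hconv : ∀ ε > 0, ∃ S : ℝ, ∀ s ≥ S,
      ∀ t ∈ Set.Icc (0:ℝ) 1, ‖α t (u s) - u s‖ ≤ ε) :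
    ∃ v : ℝ → A, ContinuousOn v (Set.Ici (0:ℝ)) ∧
      (∀ s : ℝ, 0 ≤ s → v s ∈ unitary A ∧ v s ∈ Dδ) ∧
      ∀ ε > 0, ∃ S : ℝ, ∀ s ≥ S, ‖δ (v s)‖ ≤ ε ∧ ‖u s - v s‖ ≤ ε := by
  rcases subsingleton_or_nontrivial A with hA | hA
  · refine ⟨u, hucont, fun s hs => ⟨hu s hs, (hgen _).mpr ⟨0, ?_⟩⟩, fun ε hε => ⟨0, fun s _ => ?_⟩⟩
    · exact (hasDerivAt_const (0 : ℝ) (0 : A)).congr_of_eventuallyEq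
        (.of_forall fun t => Subsingleton.elim _ _)
    · simp [Subsingleton.elim _ (0 : A), hε.le]
  have hu' : Continuous fun s => u (max s 0) :=
    hucont.comp_continuous (by fun_prop) fun s => le_max_right s 0
  have hconv' : ∀ ε > 0, ∃ S : ℝ, ∀ s ≥ S, ∀ t ∈ Set.Icc (0 : ℝ) 1,
      ‖α t (u (max s 0)) - u (max s 0)‖ ≤ ε := fun ε hε =>
    (hconv ε hε).imp fun S hS s hs => hS _ (hs.trans (le_max_left s 0))
  obtain ⟨p, hp, hp_lim⟩ := exists_continuous_flow_generator_approx hgroup hcont hu' hconv'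
    (r := 1 / 8) (by norm_num)
  have hmem : ∀ s, u (max s 0) ∈ unitary A := fun s => hu _ (le_max_right s 0)
  have hderiv := fun s =>
    exists_hasDerivAt_flow_unitaryPart hgroup (hmem s) (hp s).2.le (hp s).1
  have hD : ∀ s, unitaryPart (p s).1 ∈ Dδ := fun s =>
    (hgen _).mpr ((hderiv s).imp fun _ h => h.1)
  refine ⟨fun s => unitaryPart (p s).1, ?_, fun s _ =>
    ⟨unitaryPart_mem_unitary (hmem s) (hp s).2.le, hD s⟩, fun ε hε => ?_⟩
  · exact continuousOn_unitaryPart (by fun_prop) fun s _ =>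
      norm_star_mul_self_sub_one_le_half (hmem s) (hp s).2.le
  · obtain ⟨S, hS⟩ := hp_lim (ε / 14) (by positivity)
    refine ⟨max S 0, fun s hs => ?_⟩
    obtain ⟨hzu, hy⟩ := hS s (le_of_max_le_left hs)
    obtain ⟨y', hy', hy'_le⟩ := hderiv s
    have hclose := norm_unitaryPart_sub_le (hmem s) (hp s).2.le
    rw [max_eq_left (le_of_max_le_right hs)] at hzu hclose
    rw [(hδ _ (hD s)).unique hy', norm_sub_rev]
    constructor <;> linarith [norm_nonneg ((p s).1 - u s)]
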